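/- arXiv:2309.06894 — 2 statements merged into one kernel-verified Lean document; each statement's English description precedes it below -/
import Mathlib

section
/- (Incompatibility of the Lanczos algebraic gauge.) Suppose Z_{abc} is in decomposed form with respect to u with fields (P, Q, Ψ, Φ), and suppose the Lanczos algebraic gauge holds: Σ_{a,d} η^{ad} Z_{dba} = 0 for every b. Then P_b = 0 for every b and the trace Ψ = Σ_{a,b} η^{ab} Ψ_{ab} vanishes. -/
open Finset

/-- Minkowski metric η_{ab} = diag(-1,1,1,1). -/
def gMetric (a b : Fin 4) : ℝ :=
  if a = b then (if a = 0 then -1 else 1) else 0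

/-- Inverse Minkowski metric η^{ab} = diag(-1,1,1,1). -/
def gInv (a b : Fin 4) : ℝ :=
  if a = b then (if a = 0 then -1 else 1) else 0

/-- Levi-Civita symbol ε_{abcd} with ε_{0123} = 1. -/
def eps4 (a b c d : Fin 4) : ℝ :=
  (Int.sign (((b : ℤ) - (a : ℤ)) * ((c : ℤ) - (a : ℤ)) * ((d : ℤ) - (a : ℤ)) *
      ((c : ℤ) - (b : ℤ)) * ((d : ℤ) - (b : ℤ)) * ((d : ℤ) - (c : ℤ))) : ℝ)

/-- Lowered index version u_a = η_{ab} u^b of a vector u^a. -/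
def uLow (u : Fin 4 → ℝ) (a : Fin 4) : ℝ := ∑ b : Fin 4, gMetric a b * u b

/-- Spatial volume form ε_{bcd} = ε_{abcd} u^a. -/
def epsSp (u : Fin 4 → ℝ) (b c d : Fin 4) : ℝ := ∑ a : Fin 4, eps4 a b c d * u a

/-- Spatial volume form with the last index raised: ε_{bc}{}^{d} = ε_{bce} η^{ed}. -/
def epsSpUpLast (u : Fin 4 → ℝ) (b c d : Fin 4) : ℝ :=
  ∑ e : Fin 4, epsSp u b c e * gInv e d

/-- Spatial volume form with the first index raised: ε^{d}{}_{bc} = η^{de} ε_{ebc}. -/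
def epsSpUpFirst (u : Fin 4 → ℝ) (d b c : Fin 4) : ℝ :=
  ∑ e : Fin 4, gInv d e * epsSp u e b c

/-- `Z` is in decomposed form with respect to `u` with fields `(P, Q, Ψ, Φ)`:
`P`, `Q` are spatial vectors; `Ψ`, `Φ` are symmetric spatial rank-2 tensors; and
`Z_{abc} = -2η_{a[b} P_{c]} + ε_{bc}{}^{d} Φ_{ad} + 2u_{[b} Ψ_{c]a}
           - ε^{d}{}_{bc} u_a Q_d + 2ε^{d}{}_{a[c} u_{b]} Q_d`. -/
def IsDecomposed (Z : Fin 4 → Fin 4 → Fin 4 → ℝ) (u : Fin 4 → ℝ)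
    (P Q : Fin 4 → ℝ) (Ψ Φ : Fin 4 → Fin 4 → ℝ) : Prop :=
  (∑ a : Fin 4, P a * u a = 0) ∧ (∑ a : Fin 4, Q a * u a = 0) ∧
  (∀ a b, Ψ a b = Ψ b a) ∧ (∀ a b, Φ a b = Φ b a) ∧
  (∀ a, ∑ b : Fin 4, Ψ a b * u b = 0) ∧ (∀ a, ∑ b : Fin 4, Φ a b * u b = 0) ∧
  (∀ a b c, Z a b c =
    -(gMetric a b * P c - gMetric a c * P b)
    + (∑ d : Fin 4, epsSpUpLast u b c d * Φ a d)
    + (uLow u b * Ψ c a - uLow u c * Ψ b a)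
    - (∑ d : Fin 4, epsSpUpFirst u d b c * uLow u a * Q d)
    + (∑ d : Fin 4, (epsSpUpFirst u d a c * uLow u b - epsSpUpFirst u d a b * uLow u c) * Q d))

theorem eps4_swap_last (a b c d : Fin 4) : eps4 a b d c = -eps4 a b c d := by
  unfold eps4
  rw [← Int.cast_neg, ← Int.sign_neg]
  congr 2
  ring

theorem eps4_swap_mid (a b c d : Fin 4) : eps4 a c b d = -eps4 a b c d := by
  unfold eps4
  rw [← Int.cast_neg, ← Int.sign_neg]
  congr 2
  ring

theorem eps4_swap_ends (a b c d : Fin 4) : eps4 d b c a = -eps4 a b c d := by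
  unfold eps4
  rw [← Int.cast_neg, ← Int.sign_neg]
  congr 2
  ring

theorem sum_sum_eq_zero_of_antisymm {ι : Type*} [Fintype ι] (f : ι → ι → ℝ)
    (hf : ∀ i j, f i j = -f j i) : ∑ i, ∑ j, f i j = 0 := by
  have h : ∑ i, ∑ j, f i j = -∑ i, ∑ j, f i j := by
    conv_lhs => rw [sum_comm]
    simp only [← sum_neg_distrib]
    exact sum_congr rfl fun i _ => sum_congr rfl fun j _ => hf j i
  linarith

theorem epsSp_swap_last (u : Fin 4 → ℝ) (b c d : Fin 4) :
    epsSp u b d c = -epsSp u b c d := by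
  simp only [epsSp, ← sum_neg_distrib, eps4_swap_last _ b c d, neg_mul]

theorem epsSp_swap_first (u : Fin 4 → ℝ) (b c d : Fin 4) :
    epsSp u c b d = -epsSp u b c d := by
  simp only [epsSp, ← sum_neg_distrib, eps4_swap_mid _ b c d, neg_mul]

theorem epsSp_self_last (u : Fin 4 → ℝ) (b c : Fin 4) : epsSp u b c c = 0 := by
  linarith [epsSp_swap_last u b c c]

theorem sum_epsSp_mul (u : Fin 4 → ℝ) (b c : Fin 4) : ∑ d, epsSp u b c d * u d = 0 := by
  simp only [epsSp, sum_mul]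
  refine sum_sum_eq_zero_of_antisymm _ fun i j => ?_
  rw [eps4_swap_ends i b c j]
  ring

theorem gInv_mul_self (a : Fin 4) : gInv a a * gInv a a = 1 := by
  by_cases h : a = 0 <;> simp [gInv, h]

theorem sum_gInv_mul (f : Fin 4 → ℝ) (a : Fin 4) :
    ∑ b, gInv a b * f b = gInv a a * f a := by
  simp [gInv]

theorem gMetric_eq_gInv : gMetric = gInv := rfl

theorem uLow_eq (u : Fin 4 → ℝ) (a : Fin 4) : uLow u a = gInv a a * u a :=
  sum_gInv_mul u a

theorem gInv_comm (a b : Fin 4) : gInv a b = gInv b a := by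
  unfold gInv
  split_ifs <;> simp_all

theorem epsSpUpLast_eq (u : Fin 4 → ℝ) (b c d : Fin 4) :
    epsSpUpLast u b c d = gInv d d * epsSp u b c d := by
  simp only [epsSpUpLast, gInv_comm _ d, mul_comm _ (gInv d _), sum_gInv_mul]

theorem epsSpUpFirst_eq (u : Fin 4 → ℝ) (d b c : Fin 4) :
    epsSpUpFirst u d b c = gInv d d * epsSp u d b c :=
  sum_gInv_mul (fun e => epsSp u e b c) d

/-- The only surviving part of the trace `Z^a{}_{ba}` is `3 P_b + Ψ u_b`. -/
theorem IsDecomposed.trace_eq {Z : Fin 4 → Fin 4 → Fin 4 → ℝ} {u P Q : Fin 4 → ℝ}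
    {Ψ Φ : Fin 4 → Fin 4 → ℝ} (h : IsDecomposed Z u P Q Ψ Φ) (b : Fin 4) :
    ∑ a, ∑ d, gInv a d * Z d b a = 3 * P b + uLow u b * ∑ m, ∑ n, gInv m n * Ψ m n := by
  obtain ⟨-, -, -, hΦ, hΨu, -, hZ⟩ := h
  have hP : ∑ a, gInv a a * -(gInv a b * P a - gInv a a * P b) = 3 * P b := by
    have h1 : ∑ a, gInv a a * (gInv a b * P a) = P b := by
      simp only [gInv_comm _ b, mul_left_comm (gInv _ _) (gInv b _), sum_gInv_mul]
      rw [← mul_assoc, gInv_mul_self, one_mul]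
    simp only [mul_neg, mul_sub, ← mul_assoc (gInv _ _) (gInv _ _) (P b), gInv_mul_self,
      sum_neg_distrib, sum_sub_distrib, h1]
    simp
    ring
  have hΦ0 : ∑ a, gInv a a * ∑ d, gInv d d * epsSp u b a d * Φ a d = 0 := by
    simp only [mul_sum]
    refine sum_sum_eq_zero_of_antisymm _ fun i j => ?_
    rw [epsSp_swap_last u b j i, hΦ i j]
    ring
  have hΨ : ∑ a, gInv a a * (gInv b b * u b * Ψ a a - gInv a a * u a * Ψ b a)
      = gInv b b * u b * ∑ m, gInv m m * Ψ m m := by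
    have h1 (a : Fin 4) : gInv a a * (gInv b b * u b * Ψ a a - gInv a a * u a * Ψ b a)
        = gInv b b * u b * (gInv a a * Ψ a a) - Ψ b a * u a := by
      linear_combination (-u a * Ψ b a) * gInv_mul_self a
    simp only [h1, sum_sub_distrib, hΨu, ← mul_sum, sub_zero]
  have hQ : ∑ a, gInv a a * ∑ d, gInv d d * epsSp u d b a * (gInv a a * u a) * Q d = 0 := by
    simp only [mul_sum]
    rw [sum_comm]
    refine sum_eq_zero fun d _ => ?_
    have h1 (a : Fin 4) : gInv a a * (gInv d d * epsSp u d b a * (gInv a a * u a) * Q d)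
        = gInv d d * Q d * (epsSp u d b a * u a) := by
      linear_combination (gInv d d * epsSp u d b a * u a * Q d) * gInv_mul_self a
    simp only [h1, ← mul_sum, sum_epsSp_mul, mul_zero]
  have hQ' : ∑ a, gInv a a * ∑ d, (gInv d d * epsSp u d a a * (gInv b b * u b)
      - gInv d d * epsSp u d a b * (gInv a a * u a)) * Q d = 0 := by
    rw [← hQ]
    simp only [epsSp_self_last, epsSp_swap_last u _ b, mul_zero, zero_mul, zero_sub, mul_neg,
      neg_mul, neg_neg]
  simp only [sum_gInv_mul, hZ, gMetric_eq_gInv, uLow_eq, epsSpUpLast_eq, epsSpUpFirst_eq]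
  simp only [mul_add _ _ (Finset.sum _ _), mul_sub _ _ (Finset.sum _ _),
    mul_add _ _ (_ - _), sum_add_distrib, sum_sub_distrib, hP, hΦ0, hΨ, hQ, hQ']
  ring

/-- (Incompatibility of the Lanczos algebraic gauge.) If a Z-tensor in decomposed form
satisfies the Lanczos gauge `Z^a{}_{ba} = 0`, then `P = 0` and the trace `Ψ` vanishes. -/
theorem stmt_7 (Z : Fin 4 → Fin 4 → Fin 4 → ℝ) (u : Fin 4 → ℝ)
    (hu : ∑ a : Fin 4, ∑ b : Fin 4, gMetric a b * u a * u b = -1)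
    (P Q : Fin 4 → ℝ) (Ψ Φ : Fin 4 → Fin 4 → ℝ)
    (hdec : IsDecomposed Z u P Q Ψ Φ)
    (hgauge : ∀ b, ∑ a : Fin 4, ∑ d : Fin 4, gInv a d * Z d b a = 0) :
    (∀ b, P b = 0) ∧ (∑ m : Fin 4, ∑ n : Fin 4, gInv m n * Ψ m n) = 0 := by
  have hPu := hdec.1
  set T := ∑ m : Fin 4, ∑ n : Fin 4, gInv m n * Ψ m n with hT
  have hb (b : Fin 4) : 3 * P b + uLow u b * T = 0 := by
    rw [hT, ← hdec.trace_eq, hgauge]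
  have hu' : ∑ b, uLow u b * u b = -1 := by
    rw [← hu]
    simp only [uLow, sum_mul]
    exact sum_congr rfl fun a _ => sum_congr rfl fun b _ => by ring
  have hT0 : T = 0 := by
    have h1 : ∑ b, (3 * P b + uLow u b * T) * u b =
        3 * ∑ b, P b * u b + T * ∑ b, uLow u b * u b := by
      simp only [mul_sum, ← sum_add_distrib]
      exact sum_congr rfl fun b _ => by ring
    simp only [hb, zero_mul, sum_const_zero, hPu, hu'] at h1
    linarith
  refine ⟨fun b => ?_, hT0⟩
  have := hb b
  rw [hT0] at this
  linarith
end

section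
/- (Uniqueness of the irreducible decomposition.) Suppose the rank-3 tensor Z_{abc} is in decomposed form with respect to u both with fields (P, Q, Ψ, Φ) and with fields (P', Q', Ψ', Φ'). Then P = P', Q = Q', Ψ = Ψ' and Φ = Φ' (componentwise). -/
open Finset

theorem eps4_swap_first (a b c d : Fin 4) : eps4 b a c d = -eps4 a b c d := by
  unfold eps4
  rw [← Int.cast_neg, ← Int.sign_neg]
  congr 2
  ring

theorem gMetric_comm (a b : Fin 4) : gMetric a b = gMetric b a :=
  gInv_comm a b

theorem epsSpUpLast_swap (u : Fin 4 → ℝ) (b c d : Fin 4) :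
    epsSpUpLast u c b d = -epsSpUpLast u b c d := by
  simp only [epsSpUpLast, epsSp, eps4_swap_mid _ b c, neg_mul, sum_neg_distrib]

/-- Cyclic symmetry of the spatial volume form. -/
theorem epsSpUpFirst_eq_epsSpUpLast (u : Fin 4 → ℝ) (b c d : Fin 4) :
    epsSpUpFirst u d b c = epsSpUpLast u b c d := by
  unfold epsSpUpFirst epsSpUpLast epsSp
  refine sum_congr rfl fun e _ => ?_
  rw [mul_comm, gInv_comm]
  congr 1
  refine sum_congr rfl fun a _ => ?_
  rw [eps4_swap_mid a b e c, eps4_swap_last a b c e, neg_neg]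

/-- The spatial volume form is orthogonal to `u`. -/
theorem sum_mul_epsSp (u : Fin 4 → ℝ) (c d : Fin 4) : ∑ b, u b * epsSp u b c d = 0 := by
  have h : ∑ b, u b * epsSp u b c d = -∑ b, u b * epsSp u b c d := by
    simp only [epsSp, mul_sum, ← sum_neg_distrib]
    rw [sum_comm]
    refine sum_congr rfl fun a _ => sum_congr rfl fun b _ => ?_
    rw [eps4_swap_first]
    ring
  linarith

/-- The dual `ε_{bc}{}^{d} v_d` of a covector `v`. -/
def spatialDual (u v : Fin 4 → ℝ) (b c : Fin 4) : ℝ := ∑ d, epsSpUpLast u b c d * v d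

theorem spatialDual_swap (u v : Fin 4 → ℝ) (b c : Fin 4) :
    spatialDual u v c b = -spatialDual u v b c := by
  simp only [spatialDual, epsSpUpLast_swap u b c, neg_mul, sum_neg_distrib]

theorem sum_mul_spatialDual_left (u v : Fin 4 → ℝ) (c : Fin 4) :
    ∑ b, u b * spatialDual u v b c = 0 := by
  have h : ∑ b, u b * spatialDual u v b c =
      ∑ d, ∑ e, (∑ b, u b * epsSp u b c e) * (gInv e d * v d) := by
    simp only [spatialDual, epsSpUpLast, mul_sum, sum_mul]
    rw [sum_comm]
    refine sum_congr rfl fun d _ => ?_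
    rw [sum_comm]
    exact sum_congr rfl fun e _ => sum_congr rfl fun b _ => by ring
  simp [h, sum_mul_epsSp]

/-- A spatial covector with vanishing dual vanishes. -/
theorem eq_zero_of_spatialDual_eq_zero {u v : Fin 4 → ℝ} (hu : ∑ a, uLow u a * u a = -1)
    (hv : ∑ a, v a * u a = 0) (h : ∀ b c, spatialDual u v b c = 0) : v = 0 := by
  have h01 := h 2 3
  have h02 := h 1 3
  have h03 := h 1 2
  have h12 := h 0 3
  have h13 := h 0 2
  have h23 := h 0 1
  have s2 : Int.sign 2 = 1 := rfl
  have s3 : Int.sign 3 = 1 := rfl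
  simp [spatialDual, epsSpUpLast, epsSp, eps4, gInv, Fin.sum_univ_four, s2, s3]
    at h01 h02 h03 h12 h13 h23
  simp [uLow, gMetric, Fin.sum_univ_four] at hu hv
  ext a
  fin_cases a
  · change v 0 = 0
    linear_combination v 0 * hu - (u 1 * h01 - u 2 * h02 + u 3 * h03) + u 0 * hv
  · change v 1 = 0
    linear_combination v 1 * hu + u 0 * h01 - u 1 * hv + u 2 * h12 - u 3 * h13
  · change v 2 = 0
    linear_combination v 2 * hu - u 0 * h02 - u 2 * hv - u 1 * h12 + u 3 * h23
  · change v 3 = 0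
    linear_combination v 3 * hu + u 0 * h03 - u 3 * hv + u 1 * h13 - u 2 * h23

/-- The decomposed form written in terms of spatial duals. -/
theorem IsDecomposed.eq_spatialDual {Z : Fin 4 → Fin 4 → Fin 4 → ℝ} {u P Q : Fin 4 → ℝ}
    {Ψ Φ : Fin 4 → Fin 4 → ℝ} (h : IsDecomposed Z u P Q Ψ Φ) (a b c : Fin 4) :
    Z a b c = -(gMetric a b * P c - gMetric a c * P b) + spatialDual u (Φ a) b c
      + (uLow u b * Ψ c a - uLow u c * Ψ b a) - uLow u a * spatialDual u Q b c
      + (uLow u b * spatialDual u Q a c - uLow u c * spatialDual u Q a b) := by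
  rw [h.2.2.2.2.2.2 a b c]
  simp only [epsSpUpFirst_eq_epsSpUpLast, spatialDual, mul_sum, ← sum_sub_distrib]
  congr 1
  · congr 1
    exact sum_congr rfl fun d _ => by ring
  · exact sum_congr rfl fun d _ => by ring

theorem IsDecomposed.sub {Z Z' : Fin 4 → Fin 4 → Fin 4 → ℝ} {u P Q P' Q' : Fin 4 → ℝ}
    {Ψ Φ Ψ' Φ' : Fin 4 → Fin 4 → ℝ} (h : IsDecomposed Z u P Q Ψ Φ)
    (h' : IsDecomposed Z' u P' Q' Ψ' Φ') :
    IsDecomposed (Z - Z') u (P - P') (Q - Q') (Ψ - Ψ') (Φ - Φ') := by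
  obtain ⟨hP, hQ, hΨ, hΦ, hΨu, hΦu, hZ⟩ := h
  obtain ⟨hP', hQ', hΨ', hΦ', hΨu', hΦu', hZ'⟩ := h'
  refine ⟨?_, ?_, fun a b => ?_, fun a b => ?_, fun a => ?_, fun a => ?_, fun a b c => ?_⟩
  · simp [sub_mul, hP, hP']
  · simp [sub_mul, hQ, hQ']
  · simp [hΨ a b, hΨ' a b]
  · simp [hΦ a b, hΦ' a b]
  · simp [sub_mul, hΨu, hΨu']
  · simp [sub_mul, hΦu, hΦu']
  · simp only [Pi.sub_apply, hZ, hZ', mul_sub, sum_sub_distrib]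
    ring

theorem sum_uLow_mul_self {u : Fin 4 → ℝ}
    (hu : ∑ a, ∑ b, gMetric a b * u a * u b = -1) : ∑ a, uLow u a * u a = -1 := by
  rw [← hu]
  simp only [uLow, sum_mul]
  exact sum_congr rfl fun a _ => sum_congr rfl fun b _ => by ring

/-- The fields of a decomposed form of the zero tensor vanish. -/
theorem IsDecomposed.eq_zero {u P Q : Fin 4 → ℝ} {Ψ Φ : Fin 4 → Fin 4 → ℝ}
    (hu : ∑ a, uLow u a * u a = -1) (h : IsDecomposed 0 u P Q Ψ Φ) :
    P = 0 ∧ Q = 0 ∧ Ψ = 0 ∧ Φ = 0 := by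
  have hZ := h.eq_spatialDual
  simp only [Pi.zero_apply] at hZ
  obtain ⟨hP, hQ, hΨ, hΦ, hΨu, hΦu, -⟩ := h
  have hη (b : Fin 4) : ∑ a, gMetric a b * u a = uLow u b := by
    simp only [uLow, gMetric_comm]
  have hΦdual (b c : Fin 4) : ∑ a, u a * spatialDual u (Φ a) b c = 0 := by
    simp only [spatialDual, mul_sum]
    rw [sum_comm]
    refine sum_eq_zero fun d _ => ?_
    rw [← mul_zero (epsSpUpLast u b c d), ← hΦu d, mul_sum]
    exact sum_congr rfl fun a _ => by rw [hΦ a d]; ring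
  have hfirst (b c : Fin 4) :
      -(uLow u b * P c - uLow u c * P b) + spatialDual u Q b c = 0 := by
    have e1 := hη b
    have e2 := hη c
    have e3 := hΦdual b c
    have e4 := hΨu b
    have e5 := hΨu c
    have e6 := sum_mul_spatialDual_left u Q b
    have e7 := sum_mul_spatialDual_left u Q c
    simp only [Fin.sum_univ_four] at e1 e2 e3 e4 e5 e6 e7 hu
    linear_combination -(u 0 * hZ 0 b c + u 1 * hZ 1 b c + u 2 * hZ 2 b c + u 3 * hZ 3 b c)
      + P c * e1 - P b * e2 - e3 - uLow u b * e5 + uLow u c * e4 + spatialDual u Q b c * hu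
      - uLow u b * e7 + uLow u c * e6
  have hP0 : P = 0 := by
    ext c
    have e1 := sum_mul_spatialDual_left u Q c
    simp only [Fin.sum_univ_four] at e1 hu hP
    simp only [Pi.zero_apply]
    linear_combination u 0 * hfirst 0 c + u 1 * hfirst 1 c + u 2 * hfirst 2 c + u 3 * hfirst 3 c
      - e1 + P c * hu - uLow u c * hP
  subst hP0
  have hQdual (b c : Fin 4) : spatialDual u Q b c = 0 := by simpa using hfirst b c
  have hQ0 : Q = 0 := eq_zero_of_spatialDual_eq_zero hu hQ hQdual
  have hsecond (a b c : Fin 4) :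
      spatialDual u (Φ a) b c + (uLow u b * Ψ c a - uLow u c * Ψ b a) = 0 := by
    simpa [hQdual] using (hZ a b c).symm
  have hΨ0 : Ψ = 0 := by
    ext c a
    have e1 := sum_mul_spatialDual_left u (Φ a) c
    have e2 := hΨu a
    simp only [Fin.sum_univ_four, hΨ a] at e1 e2 hu
    simp only [Pi.zero_apply]
    linear_combination -(u 0 * hsecond a 0 c + u 1 * hsecond a 1 c + u 2 * hsecond a 2 c
      + u 3 * hsecond a 3 c) + e1 + Ψ c a * hu - uLow u c * e2
  subst hΨ0
  refine ⟨rfl, hQ0, rfl, funext fun a => eq_zero_of_spatialDual_eq_zero hu (hΦu a) fun b c => ?_⟩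
  simpa using hsecond a b c

/-- (Uniqueness of the irreducible decomposition.) If `Z` is in decomposed form with
respect to `u` with fields `(P, Q, Ψ, Φ)` and also with fields `(P', Q', Ψ', Φ')`,
then the fields coincide. -/
theorem stmt_11 (Z : Fin 4 → Fin 4 → Fin 4 → ℝ) (u : Fin 4 → ℝ)
    (hu : ∑ a : Fin 4, ∑ b : Fin 4, gMetric a b * u a * u b = -1)
    (P Q P' Q' : Fin 4 → ℝ) (Ψ Φ Ψ' Φ' : Fin 4 → Fin 4 → ℝ)
    (hdec : IsDecomposed Z u P Q Ψ Φ)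
    (hdec' : IsDecomposed Z u P' Q' Ψ' Φ') :
    (∀ a, P a = P' a) ∧ (∀ a, Q a = Q' a) ∧
    (∀ a b, Ψ a b = Ψ' a b) ∧ (∀ a b, Φ a b = Φ' a b) := by
  have hd := hdec.sub hdec'
  rw [sub_self] at hd
  obtain ⟨hP, hQ, hΨ, hΦ⟩ := hd.eq_zero (sum_uLow_mul_self hu)
  rw [sub_eq_zero] at hP hQ hΨ hΦ
  simp [hP, hQ, hΨ, hΦ]
end
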